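/- arXiv:1306.5693 — 3 statements merged into one kernel-verified Lean document; each statement's English description precedes it below -/
import Mathlib

section
/- Let V be a finite-dimensional vector space over ℚ, let W be a finite increasing filtration on V, and let N : V → V be a nilpotent linear map with N(W_w) ⊆ W_w for all w. If W'⁽¹⁾ and W'⁽²⁾ are both relative monodromy filtrations of N with respect to W, then W'⁽¹⁾_w = W'⁽²⁾_w for all w ∈ ℤ (i.e., the relative monodromy filtration, if it exists, is unique). -/
open Submodule

section Defs

variable {V : Type*} [AddCommGroup V] [Module ℚ V]

/-- A finite increasing filtration on `V` indexed by `ℤ`: a monotone family of subspaces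
which is `⊥` for all sufficiently small indices and `⊤` for all sufficiently large indices. -/
def IsFiniteFiltration (W : ℤ → Submodule ℚ V) : Prop :=
  Monotone W ∧ (∃ a : ℤ, ∀ w : ℤ, w ≤ a → W w = ⊥) ∧ (∃ b : ℤ, ∀ w : ℤ, b ≤ w → W w = ⊤)

/-- `grSub W W' w n = (W'_n ⊓ W_w) ⊔ W_{w-1}`, the submodule of `V` such that
`gr^{W'}_n gr^W_w = grSub W W' w n / grSub W W' w (n-1)`. -/
def grSub (W W' : ℤ → Submodule ℚ V) (w n : ℤ) : Submodule ℚ V :=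
  (W' n ⊓ W w) ⊔ W (w - 1)

/-- `W'` is the relative monodromy filtration of the nilpotent endomorphism `N` with respect to
the filtration `W`:  `W'` is a finite increasing filtration, `N W'_w ⊆ W'_{w-2}` for all `w`, and
for all `w` and `m ≥ 0` the map induced by `N^m` from `gr^{W'}_{w+m} gr^W_w` to
`gr^{W'}_{w-m} gr^W_w` is well defined and bijective (expressed on the level of submodules
of `V`). -/
def IsRelMonFil (N : Module.End ℚ V) (W W' : ℤ → Submodule ℚ V) : Prop :=
  IsFiniteFiltration W' ∧
  (∀ w : ℤ, ∀ x ∈ W' w, N x ∈ W' (w - 2)) ∧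
  ∀ (w : ℤ) (m : ℕ),
    (∀ x ∈ grSub W W' w (w + m), (N ^ m) x ∈ grSub W W' w (w - m)) ∧
    (∀ x ∈ grSub W W' w (w + m - 1), (N ^ m) x ∈ grSub W W' w (w - m - 1)) ∧
    (∀ x ∈ grSub W W' w (w + m), (N ^ m) x ∈ grSub W W' w (w - m - 1) →
      x ∈ grSub W W' w (w + m - 1)) ∧
    grSub W W' w (w - m) ≤
      Submodule.map (N ^ m : Module.End ℚ V) (grSub W W' w (w + m)) ⊔ grSub W W' w (w - m - 1)

/-- The filtration induced on `End(V)` by a filtration `W` on `V`: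
`W_k End(V) = {f | f(W_w) ⊆ W_{w+k} for all w}`. -/
def endFilt (W : ℤ → Submodule ℚ V) (k : ℤ) : Submodule ℚ (Module.End ℚ V) where
  carrier := {f | ∀ w : ℤ, ∀ x ∈ W w, f x ∈ W (w + k)}
  add_mem' := fun hf hg w x hx => by
    simpa using (W (w + k)).add_mem (hf w x hx) (hg w x hx)
  zero_mem' := fun w x _ => by simp
  smul_mem' := fun c f hf w x hx => by
    simpa using (W (w + k)).smul_mem c (hf w x hx)

/-- `Ad(N) : End(V) → End(V)`, `f ↦ N ∘ f - f ∘ N`, as an endomorphism of `End(V)`. -/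
def adE (N : Module.End ℚ V) : Module.End ℚ (Module.End ℚ V) :=
  LinearMap.mulLeft ℚ N - LinearMap.mulRight ℚ N

/-- `U` is a splitting of the filtration `W`: `V = ⊕_w U_w` and `W_w = Σ_{n ≤ w} U_n`. -/
def IsSplitting (W U : ℤ → Submodule ℚ V) : Prop :=
  DirectSum.IsInternal U ∧ ∀ w : ℤ, W w = ⨆ n ≤ w, U n

/-- `c` is the weight decomposition of `f` with respect to the grading `U` of `V`:
`f = Σ_w c_w` (a finite sum) and `c_w (U_m) ⊆ U_{m+w}` for all `m`. -/
def IsWeightDecomp (U : ℤ → Submodule ℚ V) (f : Module.End ℚ V)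
    (c : ℤ → Module.End ℚ V) : Prop :=
  (Function.support c).Finite ∧ (∑ᶠ w : ℤ, c w) = f ∧
  ∀ w m : ℤ, ∀ x ∈ U m, (c w) x ∈ U (m + w)

/-- `U` is the Deligne splitting of `W` associated to the splitting `U'` of `W'`:
a splitting of `W` such that `V = ⊕_{m,n} (U_m ∩ U'_n)` and, for any weight decomposition
`c` of `N` with respect to `U`, the class `N̄_{-1}` of `c_{-1}` in
`gr^{W'}_{-2} gr^W_{-1} End(V)` vanishes and, for `w ≤ -2`, the class `N̄_w` of `c_w`
in `gr^{W'}_{-2} gr^W_w End(V)` lies in the primitive component, i.e. is killed by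
the map induced by `Ad(N)^{-w-1}` to `gr^{W'}_{2w} gr^W_w End(V)`. -/
def IsDeligneSplitting (N : Module.End ℚ V) (W W' U' U : ℤ → Submodule ℚ V) : Prop :=
  IsSplitting W U ∧
  DirectSum.IsInternal (fun p : ℤ × ℤ => U p.1 ⊓ U' p.2) ∧
  ∀ c : ℤ → Module.End ℚ V, IsWeightDecomp U N c →
    c (-1) ∈ grSub (endFilt W) (endFilt W') (-1) (-3) ∧
    ∀ w : ℤ, w ≤ -2 →
      c w ∈ grSub (endFilt W) (endFilt W') w (-2) ∧
      ((adE N) ^ (-w - 1).toNat) (c w) ∈ grSub (endFilt W) (endFilt W') w (2 * w - 1)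

end Defs

section RelMonFil

variable {V : Type*} [AddCommGroup V] [Module ℚ V] {N : Module.End ℚ V}
  {W W' W'₁ W'₂ : ℤ → Submodule ℚ V}

theorem pow_apply_mem_of_apply_mem (hN : ∀ w : ℤ, ∀ x ∈ W w, N x ∈ W w) (k : ℕ) {w : ℤ} {x : V}
    (hx : x ∈ W w) : (N ^ k) x ∈ W w := by
  induction k with
  | zero => simpa using hx
  | succ k ih => rw [pow_succ', Module.End.mul_apply]; exact hN _ _ ih

theorem pow_apply_mem_of_apply_mem_sub_two (hN : ∀ w : ℤ, ∀ x ∈ W' w, N x ∈ W' (w - 2)) (k : ℕ)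
    {w : ℤ} {x : V} (hx : x ∈ W' w) : (N ^ k) x ∈ W' (w - 2 * k) := by
  induction k with
  | zero => simpa using hx
  | succ k ih =>
    rw [pow_succ', Module.End.mul_apply]
    have h := hN _ _ ih
    rwa [show w - 2 * (k : ℤ) - 2 = w - 2 * ((k + 1 : ℕ) : ℤ) by push_cast; ring] at h

theorem IsFiniteFiltration.induction_on (hW : IsFiniteFiltration W) {P : ℤ → Prop}
    (bot : ∀ w, W w = ⊥ → P w) (step : ∀ w, P (w - 1) → P w) (w : ℤ) : P w := by
  obtain ⟨a, ha⟩ := hW.2.1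
  rcases le_total w a with h | h
  · exact bot w (ha w h)
  · induction w, h using Int.leInduction with
    | base => exact bot a (ha a le_rfl)
    | succ n _ ih => exact step _ (by simpa using ih)

/-- An element of `W w` lies in `W' (w + l)` as soon as its image under `N ^ (l + 1)` lies in
`W' (w - l - 2)`. -/
theorem IsRelMonFil.mem_of_pow_apply_mem (hW : IsFiniteFiltration W)
    (hNW : ∀ w : ℤ, ∀ x ∈ W w, N x ∈ W w) (h : IsRelMonFil N W W') (w : ℤ) (l : ℕ) {x : V}
    (hx : x ∈ W w) (hNx : (N ^ (l + 1)) x ∈ W' (w - l - 2)) :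
    x ∈ W' (w + l) := by
  obtain ⟨⟨mono, -, b, hb⟩, hN, hgr⟩ := h
  induction w using hW.induction_on generalizing l x with
  | bot w hw =>
    rw [hw, Submodule.mem_bot] at hx
    simp [hx]
  | step w ih =>
    have descend : ∀ j : ℕ, x ∈ W' (w + l + j) → x ∈ W' (w + l) := by
      intro j
      induction j with
      | zero => simp
      | succ j ihj =>
        intro hxj
        have hNk : (N ^ (l + j + 1)) x ∈ W' (w - (l + j + 1 : ℕ) - 1) := by
          have h1 := pow_apply_mem_of_apply_mem_sub_two hN j hNx
          rw [← Module.End.mul_apply, ← pow_add, show j + (l + 1) = l + j + 1 by ring] at h1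
          exact mono (by push_cast; lia) h1
        have hxk : x ∈ W' (w + (l + j + 1 : ℕ)) := mono (by push_cast; lia) hxj
        obtain ⟨y, ⟨hy, -⟩, z, hz, hyz⟩ := Submodule.mem_sup.1 <|
          (hgr w (l + j + 1)).2.2.1 x (Submodule.mem_sup_left ⟨hxk, hx⟩)
            (Submodule.mem_sup_left ⟨hNk, pow_apply_mem_of_apply_mem hNW _ hx⟩)
        obtain rfl : z = x - y := by rw [← hyz]; abel
        have hNy := pow_apply_mem_of_apply_mem_sub_two hN (l + j + 1) hy
        have hNz : (N ^ (l + j + 1)) (x - y) ∈ W' (w - (l + j + 1 : ℕ) - 1) := by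
          rw [map_sub]
          exact sub_mem hNk (mono (by push_cast; lia) hNy)
        have hz' := ih (l + j + 1) hz (by
          rw [pow_succ', Module.End.mul_apply]
          exact mono (by push_cast; lia) (hN _ _ hNz))
        apply ihj
        rw [← hyz]
        exact add_mem (mono (by push_cast; lia) hy) (mono (by push_cast; lia) hz')
    exact descend (b - (w + l)).toNat (by rw [hb _ (by lia)]; trivial)

/-- An element of `W w ⊓ W' (w - l)` is, up to smaller terms, in the image of `N ^ l`. -/
theorem IsRelMonFil.exists_eq_pow_apply_add (hNW : ∀ w : ℤ, ∀ x ∈ W w, N x ∈ W w)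
    (h : IsRelMonFil N W W') {w : ℤ} {l : ℕ} {x : V}
    (hx : x ∈ W w) (hx' : x ∈ W' (w - l)) :
    ∃ y ∈ W' (w + l) ⊓ W w, ∃ z ∈ W' (w - l - 1) ⊓ W w, ∃ u ∈ W' (w - l) ⊓ W (w - 1),
      x = (N ^ l) y + z + u := by
  obtain ⟨⟨mono, -⟩, hN, hgr⟩ := h
  obtain ⟨v, ⟨s, hs, rfl⟩, t, ht, hvt⟩ := Submodule.mem_sup.1 <|
    (hgr w l).2.2.2 (Submodule.mem_sup_left ⟨hx', hx⟩)
  obtain ⟨y, hy, y', hy', rfl⟩ := Submodule.mem_sup.1 hs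
  obtain ⟨z, hz, z', hz', rfl⟩ := Submodule.mem_sup.1 ht
  refine ⟨y, hy, z, hz, x - (N ^ l) y - z, ⟨?_, ?_⟩, by abel⟩
  · have hNy := pow_apply_mem_of_apply_mem_sub_two hN l hy.1
    exact sub_mem (sub_mem hx' (mono (by lia) hNy)) (mono (by lia) hz.1)
  · have : x - (N ^ l) y - z = (N ^ l) y' + z' := by rw [← hvt, map_add]; abel
    rw [this]
    exact add_mem (pow_apply_mem_of_apply_mem hNW l hy') hz'

theorem IsRelMonFil.inf_le (hW : IsFiniteFiltration W) (hNW : ∀ w : ℤ, ∀ x ∈ W w, N x ∈ W w)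
    (h₁ : IsRelMonFil N W W'₁) (h₂ : IsRelMonFil N W W'₂) (w : ℤ) :
    ∀ n : ℤ, W'₁ n ⊓ W w ≤ W'₂ n := by
  induction w using hW.induction_on with
  | bot w hw => simp [hw]
  | step w ih =>
    obtain ⟨a, ha⟩ := h₁.1.2.1
    obtain ⟨b, hb⟩ := h₂.1.2.2
    have key : ∀ j l : ℕ, w - a ≤ l + j → b - w ≤ l + j →
        W'₁ (w + l) ⊓ W w ≤ W'₂ (w + l) ∧ W'₁ (w - l) ⊓ W w ≤ W'₂ (w - l) := by
      intro j
      induction j using Nat.strong_induction_on with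
      | _ j ihj =>
        intro l hal hbl
        rcases Nat.eq_zero_or_pos j with rfl | hj
        · constructor
          · rw [hb _ (by lia)]; exact le_top
          · rw [ha _ (by lia), bot_inf_eq]; exact bot_le
        have hsucc := (ihj (j - 1) (by lia) (l + 1) (by push_cast; lia) (by push_cast; lia)).2
        have hsucc₂ := (ihj (j - 2) (by lia) (l + 2) (by push_cast; lia) (by push_cast; lia)).2
        have hadd : W'₁ (w + l) ⊓ W w ≤ W'₂ (w + l) := by
          rintro x ⟨hx', hx⟩
          refine h₂.mem_of_pow_apply_mem hW hNW w l hx ?_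
          have hNx := pow_apply_mem_of_apply_mem_sub_two h₁.2.1 (l + 1) hx'
          rw [show w - (l : ℤ) - 2 = w - ((l + 2 : ℕ) : ℤ) by push_cast; ring]
          exact hsucc₂ ⟨h₁.1.1 (by push_cast; lia) hNx, pow_apply_mem_of_apply_mem hNW _ hx⟩
        refine ⟨hadd, ?_⟩
        rintro x ⟨hx', hx⟩
        obtain ⟨y, hy, z, hz, u, hu, rfl⟩ := h₁.exists_eq_pow_apply_add hNW hx hx'
        have hNy := pow_apply_mem_of_apply_mem_sub_two h₂.2.1 l (hadd hy)
        refine add_mem (add_mem (h₂.1.1 (by lia) hNy) ?_) (ih _ hu)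
        exact h₂.1.1 (by push_cast; lia)
          (hsucc ⟨h₁.1.1 (by push_cast; lia) hz.1, hz.2⟩)
    intro n
    have hn := key ((w - a).toNat + (b - w).toNat) (n - w).natAbs (by lia) (by lia)
    rcases le_total w n with h | h
    · rw [show n = w + ((n - w).natAbs : ℤ) by lia]
      exact hn.1
    · rw [show n = w - ((n - w).natAbs : ℤ) by lia]
      exact hn.2

theorem IsRelMonFil.le (hW : IsFiniteFiltration W) (hNW : ∀ w : ℤ, ∀ x ∈ W w, N x ∈ W w)
    (h₁ : IsRelMonFil N W W'₁) (h₂ : IsRelMonFil N W W'₂) : W'₁ ≤ W'₂ := by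
  intro n
  obtain ⟨b, hb⟩ := hW.2.2
  simpa [hb b le_rfl] using h₁.inf_le hW hNW h₂ b n

end RelMonFil

/-- the relative monodromy filtration of a nilpotent endomorphism `N`
(preserving a finite increasing filtration `W`) with respect to `W` is unique if it exists. -/
theorem relative_monodromy_filtration_unique
    {V : Type*} [AddCommGroup V] [Module ℚ V] [FiniteDimensional ℚ V]
    (W W'₁ W'₂ : ℤ → Submodule ℚ V) (hW : IsFiniteFiltration W)
    (N : Module.End ℚ V) (hNnil : IsNilpotent N)
    (hNW : ∀ w : ℤ, ∀ x ∈ W w, N x ∈ W w)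
    (h₁ : IsRelMonFil N W W'₁) (h₂ : IsRelMonFil N W W'₂) :
    ∀ w : ℤ, W'₁ w = W'₂ w := by
  exact fun w => le_antisymm (h₁.le hW hNW h₂ w) (h₂.le hW hNW h₁ w)
end

section
/- Let V be a finite-dimensional vector space over ℚ, W a finite increasing filtration on V, N : V → V nilpotent with N(W_w) ⊆ W_w for all w, and let W' be the relative monodromy filtration of N with respect to W. Then for every w ∈ ℤ and m ≥ 0, the space gr^{W'}_{w+m} gr^W_w is the internal direct sum A ⊕ B, where A is the kernel of the map gr^{W'}_{w+m} gr^W_w → gr^{W'}_{w−m−2} gr^W_w induced by N^{m+1}, and B is the image of the map gr^{W'}_{w+m+2} gr^W_w → gr^{W'}_{w+m} gr^W_w induced by N. -/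
open Submodule

theorem grSub_mono {V : Type*} [AddCommGroup V] [Module ℚ V] (W : ℤ → Submodule ℚ V)
    {W' : ℤ → Submodule ℚ V} (hW' : Monotone W') (w : ℤ) : Monotone (grSub W W' w) :=
  fun _ _ hab => sup_le_sup_right (inf_le_inf_right _ (hW' hab)) _

theorem map_mem_grSub {V : Type*} [AddCommGroup V] [Module ℚ V] {W W' : ℤ → Submodule ℚ V}
    {N : Module.End ℚ V} (hNW : ∀ w : ℤ, ∀ x ∈ W w, N x ∈ W w)
    (hNW' : ∀ w : ℤ, ∀ x ∈ W' w, N x ∈ W' (w - 2)) {w n : ℤ} {x : V}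
    (hx : x ∈ grSub W W' w n) : N x ∈ grSub W W' w (n - 2) := by
  obtain ⟨y, hy, z, hz, rfl⟩ := Submodule.mem_sup.1 hx
  rw [map_add]
  exact Submodule.add_mem_sup ⟨hNW' _ _ hy.1, hNW _ _ hy.2⟩ (hNW _ _ hz)

theorem pow_map_mem_grSub {V : Type*} [AddCommGroup V] [Module ℚ V] {W W' : ℤ → Submodule ℚ V}
    {N : Module.End ℚ V} (hNW : ∀ w : ℤ, ∀ x ∈ W w, N x ∈ W w)
    (hNW' : ∀ w : ℤ, ∀ x ∈ W' w, N x ∈ W' (w - 2)) (k : ℕ) {w n : ℤ} {x : V}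
    (hx : x ∈ grSub W W' w n) : (N ^ k) x ∈ grSub W W' w (n - 2 * k) := by
  induction k with
  | zero => simpa using hx
  | succ k ih =>
    rw [pow_succ', Module.End.mul_apply,
      show n - 2 * ((k + 1 : ℕ) : ℤ) = n - 2 * k - 2 by push_cast; ring]
    exact map_mem_grSub hNW hNW' ih

/-- for the relative monodromy filtration `W'` of `N` with respect to `W`,
each graded piece `gr^{W'}_{w+m} gr^W_w = grSub W W' w (w+m) / grSub W W' w (w+m-1)`
is the internal direct sum `A ⊕ B`, where `A` is the kernel of the map to
`gr^{W'}_{w-m-2} gr^W_w` induced by `N^{m+1}` and `B` is the image of the map from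
`gr^{W'}_{w+m+2} gr^W_w` induced by `N`.  On the level of submodules of `V` (containing
the common denominator `grSub W W' w (w+m-1)`), `A` corresponds to
`grSub W W' w (w+m) ⊓ comap (N^{m+1}) (grSub W W' w (w-m-3))` and `B` to
`map N (grSub W W' w (w+m+2)) ⊔ grSub W W' w (w+m-1)`; the internal direct sum
statement says their join is the numerator and their meet is the denominator. -/
theorem gr_primitive_decomposition
    {V : Type*} [AddCommGroup V] [Module ℚ V] [FiniteDimensional ℚ V]
    (W W' : ℤ → Submodule ℚ V) (hW : IsFiniteFiltration W)
    (N : Module.End ℚ V) (hNnil : IsNilpotent N)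
    (hNW : ∀ w : ℤ, ∀ x ∈ W w, N x ∈ W w)
    (h : IsRelMonFil N W W') :
    ∀ (w : ℤ) (m : ℕ),
      (grSub W W' w (w + m) ⊓
          Submodule.comap (N ^ (m + 1) : Module.End ℚ V) (grSub W W' w (w - m - 3))) ⊔
        (Submodule.map N (grSub W W' w (w + m + 2)) ⊔ grSub W W' w (w + m - 1)) =
          grSub W W' w (w + m) ∧
      (grSub W W' w (w + m) ⊓
          Submodule.comap (N ^ (m + 1) : Module.End ℚ V) (grSub W W' w (w - m - 3))) ⊓
        (Submodule.map N (grSub W W' w (w + m + 2)) ⊔ grSub W W' w (w + m - 1)) =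
          grSub W W' w (w + m - 1) := by
  intro w m
  obtain ⟨⟨hmono, -, -⟩, hNW', hiso⟩ := h
  have hG := grSub_mono W hmono w
  obtain ⟨-, -, hinj, hsurj⟩ := hiso w (m + 2)
  rw [show w + ((m + 2 : ℕ) : ℤ) = w + m + 2 by push_cast; ring,
    show w - ((m + 2 : ℕ) : ℤ) = w - m - 2 by push_cast; ring] at hinj hsurj
  rw [show (w - m - 2 - 1 : ℤ) = w - m - 3 by ring] at hinj hsurj
  rw [show (w + m + 2 - 1 : ℤ) = w + m + 1 by ring] at hinj
  have hN (y : V) (hy : y ∈ grSub W W' w (w + m + 2)) : N y ∈ grSub W W' w (w + m) := by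
    simpa using map_mem_grSub hNW hNW' hy
  have hlow (z : V) (hz : z ∈ grSub W W' w (w + m - 1)) :
      (N ^ (m + 1)) z ∈ grSub W W' w (w - m - 3) := by
    convert pow_map_mem_grSub hNW hNW' (m + 1) hz using 2
    push_cast
    ring
  have hpow (y : V) : (N ^ (m + 1)) (N y) = (N ^ (m + 2)) y := by
    rw [pow_succ N (m + 1), Module.End.mul_apply]
  have hle : grSub W W' w (w + m - 1) ≤ grSub W W' w (w + m) := hG (by lia)
  constructor
  · apply le_antisymm
    · refine sup_le inf_le_left (sup_le ?_ hle)
      rintro _ ⟨y, hy, rfl⟩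
      exact hN y hy
    · intro x hx
      have hx' : (N ^ (m + 1)) x ∈ grSub W W' w (w - m - 2) := by
        convert pow_map_mem_grSub hNW hNW' (m + 1) hx using 2
        push_cast
        ring
      obtain ⟨_, ⟨y, hy, rfl⟩, z, hz, hyz⟩ := Submodule.mem_sup.1 (hsurj hx')
      rw [← sub_add_cancel x (N y)]
      refine Submodule.add_mem_sup ⟨sub_mem hx (hN y hy), ?_⟩
        (Submodule.mem_sup_left ⟨y, hy, rfl⟩)
      rw [SetLike.mem_coe, Submodule.mem_comap, map_sub, hpow, ← hyz, add_sub_cancel_left]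
      exact hz
  · apply le_antisymm
    · rintro x ⟨⟨-, hx⟩, hx'⟩
      obtain ⟨_, ⟨y, hy, rfl⟩, z, hz, rfl⟩ := Submodule.mem_sup.1 hx'
      rw [SetLike.mem_coe, Submodule.mem_comap, map_add, hpow] at hx
      have hy' := hinj y hy (((grSub W W' w (w - m - 3)).add_mem_iff_left (hlow z hz)).1 hx)
      refine add_mem ?_ hz
      convert map_mem_grSub hNW hNW' hy' using 2
      ring
    · exact le_inf (le_inf hle hlow) le_sup_right
end

section
/- Let V be a finite-dimensional vector space over ℚ, W a finite increasing filtration on V, N : V → V nilpotent with N(W_w) ⊆ W_w for all w, and let W' be the relative monodromy filtration of N with respect to W. Equip End(V) = Hom(V,V) with the induced filtrations W_k End(V) = {f : f(W_w) ⊆ W_{w+k} for all w} and W'_k End(V) = {f : f(W'_w) ⊆ W'_{w+k} for all w}. Then W'_• End(V) is the relative monodromy filtration of the nilpotent map Ad(N) : End(V) → End(V), f ↦ N∘f − f∘N, with respect to the filtration W_• End(V). -/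
open Submodule

/-- If a family of subspaces indexed by `ℤ × ℤ` is such that each `U p` meets trivially the sum of
the two smaller steps of the bifiltration `W' ⊓ W`, then the family is independent. -/
theorem iSupIndep_of_disjoint_bifiltration {V : Type*} [AddCommGroup V] [Module ℚ V]
    {W W' : ℤ → Submodule ℚ V} (hW : Monotone W) (hW' : Monotone W')
    {U : ℤ × ℤ → Submodule ℚ V} (hU : ∀ p, U p ≤ W' p.1 ⊓ W p.2)
    (hd : ∀ p, Disjoint (U p) ((W' (p.1 - 1) ⊓ W p.2) ⊔ (W' p.1 ⊓ W (p.2 - 1)))) :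
    iSupIndep U := by
  classical
  rw [iSupIndep_iff_finsetSum_eq_zero_imp_eq_zero]
  intro S v hv hsum
  by_contra! hne
  obtain ⟨p₀, hp₀, hp₀'⟩ := hne
  obtain ⟨p, hp, hmax⟩ := Finset.exists_max_image (S.filter fun p => v p ≠ 0)
    (fun p => toLex (p.2, p.1)) ⟨p₀, by simp [hp₀, hp₀']⟩
  obtain ⟨hpS, hp0⟩ := Finset.mem_filter.1 hp
  have hrest : v p ∈ (W' (p.1 - 1) ⊓ W p.2) ⊔ W (p.2 - 1) := by
    have h1 : v p = -∑ q ∈ S.erase p, v q := by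
      rw [← S.add_sum_erase _ hpS] at hsum
      exact eq_neg_of_add_eq_zero_left hsum
    rw [h1]
    refine neg_mem (sum_mem fun q hq => ?_)
    obtain ⟨hqp, hqS⟩ := Finset.mem_erase.1 hq
    by_cases hq0 : v q = 0
    · rw [hq0]; exact zero_mem _
    have hle := hmax q (Finset.mem_filter.2 ⟨hqS, hq0⟩)
    have hqU := hU q (hv q hqS)
    rw [Prod.Lex.toLex_le_toLex] at hle
    rcases hle with hlt | ⟨heq, hle⟩
    · exact mem_sup_right (hW (by simp only at hlt; omega) hqU.2)
    · simp only at heq hle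
      have : q.1 ≠ p.1 := fun h => hqp (Prod.ext h heq)
      exact mem_sup_left ⟨hW' (by omega) hqU.1, heq ▸ hqU.2⟩
  have hL : v p ∈ (W' (p.1 - 1) ⊓ W p.2) ⊔ (W' p.1 ⊓ W (p.2 - 1)) := by
    obtain ⟨y, hy, z, hz, hyz⟩ := mem_sup.1 hrest
    refine mem_sup.2 ⟨y, hy, z, ⟨?_, hz⟩, hyz⟩
    have : z = v p - y := by rw [← hyz]; abel
    rw [this]
    exact sub_mem (hU p (hv p hpS)).1 (hW' (by omega) hy.1)
  exact hp0 (disjoint_def.1 (hd p) _ (hv p hpS) hL)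

/-- Two finite filtrations on a finite-dimensional space admit a common adapted basis. -/
theorem exists_adapted_basis {V : Type*} [AddCommGroup V] [Module ℚ V] [FiniteDimensional ℚ V]
    {W W' : ℤ → Submodule ℚ V} (hW : IsFiniteFiltration W) (hW' : IsFiniteFiltration W') :
    ∃ (ι : Type) (_ : Fintype ι) (B : Module.Basis ι ℚ V) (a b : ι → ℤ),
      (∀ w, W w = span ℚ (B '' {s | b s ≤ w})) ∧ (∀ w, W' w = span ℚ (B '' {s | a s ≤ w})) := by
  classical
  obtain ⟨hWm, ⟨b₀, hb₀⟩, b₁, hb₁⟩ := hW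
  obtain ⟨hWm', ⟨a₀, ha₀⟩, a₁, ha₁⟩ := hW'
  have hex : ∀ p : ℤ × ℤ, ∃ U : Submodule ℚ V,
      U ⊔ ((W' (p.1 - 1) ⊓ W p.2) ⊔ (W' p.1 ⊓ W (p.2 - 1))) = W' p.1 ⊓ W p.2 ∧
      Disjoint U ((W' (p.1 - 1) ⊓ W p.2) ⊔ (W' p.1 ⊓ W (p.2 - 1))) := by
    intro p
    set L := (W' (p.1 - 1) ⊓ W p.2) ⊔ (W' p.1 ⊓ W (p.2 - 1)) with hL
    have hLle : L ≤ W' p.1 ⊓ W p.2 :=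
      sup_le (inf_le_inf_right _ (hWm' (by omega))) (inf_le_inf_left _ (hWm (by omega)))
    obtain ⟨K, hK⟩ := L.exists_isCompl
    refine ⟨K ⊓ (W' p.1 ⊓ W p.2), ?_, ?_⟩
    · rw [sup_comm, ← sup_inf_assoc_of_le _ hLle, hK.sup_eq_top, top_inf_eq]
    · exact hK.disjoint.symm.mono_left inf_le_left
  choose U hUsup hUd using hex
  have hUle : ∀ p, U p ≤ W' p.1 ⊓ W p.2 := fun p => (hUsup p) ▸ le_sup_left
  have hspan : ∀ (n : ℕ) (i j : ℤ), (i - a₀) + (j - b₀) ≤ n →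
      W' i ⊓ W j ≤ ⨆ q : {q : ℤ × ℤ // q.1 ≤ i ∧ q.2 ≤ j}, U q := by
    intro n
    induction n with
    | zero =>
      intro i j hij
      have : i ≤ a₀ ∨ j ≤ b₀ := by push_cast at hij; omega
      rcases this with h | h
      · rw [ha₀ _ h]; simp
      · rw [hb₀ _ h]; simp
    | succ n ih =>
      intro i j hij
      push_cast at hij
      have hmono : ∀ i' j', i' ≤ i → j' ≤ j →
          (⨆ q : {q : ℤ × ℤ // q.1 ≤ i' ∧ q.2 ≤ j'}, U q) ≤
            ⨆ q : {q : ℤ × ℤ // q.1 ≤ i ∧ q.2 ≤ j}, U q := fun i' j' hi hj =>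
        iSup_le fun q => le_iSup (fun q : {q : ℤ × ℤ // q.1 ≤ i ∧ q.2 ≤ j} => U q)
          ⟨q.1, q.2.1.trans hi, q.2.2.trans hj⟩
      rw [← hUsup (i, j)]
      refine sup_le ?_ (sup_le ?_ ?_)
      · exact le_iSup (fun q : {q : ℤ × ℤ // q.1 ≤ i ∧ q.2 ≤ j} => U q) ⟨(i, j), le_rfl, le_rfl⟩
      · exact (ih (i - 1) j (by omega)).trans (hmono _ _ (by omega) le_rfl)
      · exact (ih i (j - 1) (by omega)).trans (hmono _ _ le_rfl (by omega))
  have hspan' : ∀ i j : ℤ, W' i ⊓ W j ≤ ⨆ q : {q : ℤ × ℤ // q.1 ≤ i ∧ q.2 ≤ j}, U q :=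
    fun i j => hspan ((i - a₀) + (j - b₀)).toNat i j (Int.self_le_toNat _)
  have hint : DirectSum.IsInternal U := by
    rw [DirectSum.isInternal_submodule_iff_iSupIndep_and_iSup_eq_top]
    refine ⟨iSupIndep_of_disjoint_bifiltration hWm hWm' hUle hUd, top_unique ?_⟩
    have := hspan' a₁ b₁
    rw [ha₁ _ le_rfl, hb₁ _ le_rfl, inf_top_eq] at this
    exact this.trans (iSup_le fun q => le_iSup U q.1)
  let B := hint.collectedBasis fun p => Module.finBasis ℚ (U p)
  have hBmem : ∀ s, B s ∈ U s.1 := fun s => hint.collectedBasis_mem _ s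
  have hUspan : ∀ (p : ℤ × ℤ) (S : Set (Σ p : ℤ × ℤ, Fin (Module.finrank ℚ (U p)))),
      (∀ s, s.1 = p → s ∈ S) → U p ≤ span ℚ (B '' S) := by
    intro p S hS x hx
    have h1 := (Module.finBasis ℚ (U p)).sum_repr ⟨x, hx⟩
    have h2 := congrArg Subtype.val h1
    simp only [AddSubmonoidClass.coe_finsetSum, coe_smul] at h2
    rw [← h2]
    refine sum_mem fun i _ => smul_mem _ _ (subset_span ⟨⟨p, i⟩, hS _ rfl, ?_⟩)
    simp [B]
  refine ⟨_, FiniteDimensional.fintypeBasisIndex B, B, fun s => s.1.1, fun s => s.1.2, ?_, ?_⟩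
  · intro w
    refine le_antisymm ?_ (span_le.2 ?_)
    · have := hspan' a₁ w
      rw [ha₁ _ le_rfl, top_inf_eq] at this
      refine this.trans (iSup_le fun q => hUspan _ _ ?_)
      rintro s hs
      simpa [hs] using q.2.2
    · rintro _ ⟨s, hs, rfl⟩
      exact hWm hs (hUle _ (hBmem s)).2
  · intro w
    refine le_antisymm ?_ (span_le.2 ?_)
    · have := hspan' w b₁
      rw [hb₁ _ le_rfl, inf_top_eq] at this
      refine this.trans (iSup_le fun q => hUspan _ _ ?_)
      rintro s hs
      simpa [hs] using q.2.1
    · rintro _ ⟨s, hs, rfl⟩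
      exact hWm' hs (hUle _ (hBmem s)).1

/-- If `M` is orthogonal for the trace form to the commutant of `D`, then `M` is a commutator
with `D`. -/
theorem exists_commutator_of_trace_eq_zero {ι : Type*} [Fintype ι] [DecidableEq ι]
    (D M : Matrix ι ι ℚ) (h : ∀ Z : Matrix ι ι ℚ, Z * D = D * Z → (M * Z).trace = 0) :
    ∃ E : Matrix ι ι ℚ, E * D - D * E = M := by
  by_contra hM
  let ad : Matrix ι ι ℚ →ₗ[ℚ] Matrix ι ι ℚ := LinearMap.mulRight ℚ D - LinearMap.mulLeft ℚ D
  have hM' : M ∉ LinearMap.range ad := by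
    rintro ⟨E, hE⟩
    exact hM ⟨E, by simpa [ad] using hE⟩
  obtain ⟨φ, hφM, hφ⟩ := Submodule.exists_le_ker_of_notMem hM'
  let Z : Matrix ι ι ℚ := Matrix.of fun i j => φ (Matrix.single j i 1)
  have hφZ : ∀ X, φ X = (X * Z).trace := by
    intro X
    conv_lhs => rw [Matrix.matrix_eq_sum_single X]
    simp only [map_sum, Matrix.trace, Matrix.diag, Matrix.mul_apply, Z, Matrix.of_apply]
    refine Finset.sum_congr rfl fun i _ => Finset.sum_congr rfl fun j _ => ?_
    rw [← smul_eq_mul, ← map_smul, Matrix.smul_single, smul_eq_mul, mul_one]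
  have hZ : Z * D = D * Z := by
    refine Matrix.ext_iff_trace_mul_left.2 fun X => ?_
    have h1 : φ (X * D - D * X) = 0 := hφ ⟨X, by simp [ad]⟩
    rw [hφZ, sub_mul, Matrix.trace_sub, sub_eq_zero] at h1
    rw [Matrix.trace_mul_comm, ← mul_assoc, h1, mul_assoc, ← Matrix.trace_mul_comm]
  exact hφM ((hφZ M).trans (h Z hZ))

/-- Jacobson–Morozov for a bigraded space: a lowering operator `D` of bidegree `(-2, 0)` whose
powers are isomorphisms between opposite pieces admits a raising operator `E` of bidegree
`(2, 0)` such that `[E, D]` is the relative weight operator. -/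
theorem exists_raising_matrix {ι : Type*} [Fintype ι] [DecidableEq ι] (a b : ι → ℤ)
    (P : ℤ → ℤ → Matrix ι ι ℚ)
    (hP : ∀ i j, P i j = Matrix.diagonal fun s => if a s = i ∧ b s = j then 1 else 0)
    (D : Matrix ι ι ℚ) (hD : ∀ s t, D s t ≠ 0 → a s = a t - 2 ∧ b s = b t)
    (hS : ∀ (w : ℤ) (m : ℕ), ∃ S : Matrix ι ι ℚ, S * D ^ m * P (w + m) w = P (w + m) w ∧
      D ^ m * S * P (w - m) w = P (w - m) w ∧ P (w + m) w * S = S) :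
    ∃ E : Matrix ι ι ℚ, (∀ s t, E s t ≠ 0 → a s = a t + 2 ∧ b s = b t) ∧
      E * D - D * E = Matrix.diagonal fun s => ((a s - b s : ℤ) : ℚ) := by
  let comp : ℤ → Matrix ι ι ℚ → Matrix ι ι ℚ := fun d X =>
    Matrix.of fun s t => if a s = a t + d ∧ b s = b t then X s t else 0
  have hcompr : ∀ d X, comp d X * D = comp (d - 2) (X * D) := by
    intro d X
    ext s t
    simp only [comp, Matrix.mul_apply, Matrix.of_apply]
    split_ifs with h
    · refine Finset.sum_congr rfl fun u _ => ?_
      by_cases hu : D u t = 0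
      · simp [hu]
      · rw [if_pos]; have := hD u t hu; omega
    · refine Finset.sum_eq_zero fun u _ => ?_
      by_cases hu : D u t = 0
      · simp [hu]
      · rw [if_neg, zero_mul]; have := hD u t hu; omega
  have hcompl : ∀ d X, D * comp d X = comp (d - 2) (D * X) := by
    intro d X
    ext s t
    simp only [comp, Matrix.mul_apply, Matrix.of_apply]
    split_ifs with h
    · refine Finset.sum_congr rfl fun u _ => ?_
      by_cases hu : D s u = 0
      · simp [hu]
      · rw [if_pos]; have := hD s u hu; omega
    · refine Finset.sum_eq_zero fun u _ => ?_
      by_cases hu : D s u = 0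
      · simp [hu]
      · rw [if_neg, mul_zero]; have := hD s u hu; omega
  have hDP : ∀ i j, D * P i j = P (i - 2) j * D := by
    intro i j
    ext s t
    rw [hP, hP, Matrix.mul_diagonal, Matrix.diagonal_mul]
    by_cases hu : D s t = 0
    · simp [hu]
    · have := hD s t hu
      have h2 : (a t = i ∧ b t = j) ↔ (a s = i - 2 ∧ b s = j) := by omega
      simp [h2]
  have hDPm : ∀ (m : ℕ) i j, D ^ m * P i j = P (i - 2 * m) j * D ^ m := by
    intro m
    induction m with
    | zero => intro i j; simp
    | succ m ih =>
      intro i j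
      rw [pow_succ', mul_assoc, ih, ← mul_assoc, hDP, mul_assoc]
      congr 2
      push_cast; ring
  -- traces over opposite pieces agree for degree-zero elements of the commutant
  have htr : ∀ Z : Matrix ι ι ℚ, Z * D = D * Z → (∀ i j, Z * P i j = P i j * Z) →
      ∀ (w : ℤ) (m : ℕ), (Z * P (w + m) w).trace = (Z * P (w - m) w).trace := by
    intro Z hZD hZP w m
    obtain ⟨S, hS1, hS2, hS3⟩ := hS w m
    have hZDm : Z * D ^ m = D ^ m * Z := (Commute.pow_right (a := Z) (b := D) hZD m)
    have hTP : D ^ m * P (w + m) w = P (w - m) w * D ^ m := by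
      rw [hDPm]; congr 2; ring
    calc (Z * P (w + m) w).trace
        = (Z * (S * (D ^ m * P (w + m) w))).trace := by rw [← mul_assoc S, hS1]
      _ = ((Z * S) * (D ^ m * P (w + m) w)).trace := by rw [mul_assoc]
      _ = (D ^ m * P (w + m) w * (Z * S)).trace := Matrix.trace_mul_comm _ _
      _ = (P (w - m) w * (Z * (D ^ m * S))).trace := by
          rw [hTP, mul_assoc, ← mul_assoc (D ^ m), ← hZDm, mul_assoc]
      _ = ((Z * (D ^ m * S)) * P (w - m) w).trace := Matrix.trace_mul_comm _ _
      _ = (Z * P (w - m) w).trace := by rw [mul_assoc, hS2]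
  have hmain : ∃ E : Matrix ι ι ℚ,
      E * D - D * E = Matrix.diagonal fun s => ((a s - b s : ℤ) : ℚ) := by
    refine exists_commutator_of_trace_eq_zero _ _ fun Z₁ hZ₁ => ?_
    set Z := comp 0 Z₁ with hZdef
    have hZD : Z * D = D * Z := by rw [hZdef, hcompr, hcompl, hZ₁]
    have hZP : ∀ i j, Z * P i j = P i j * Z := by
      intro i j
      ext s t
      rw [hP, Matrix.mul_diagonal, Matrix.diagonal_mul]
      by_cases h : a s = a t ∧ b s = b t
      · simp [h, mul_comm]
      · have : Z s t = 0 := by simp [hZdef, comp, h]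
        simp [this]
    let τ : ℤ × ℤ → ℚ := fun p => (Z * P p.1 p.2).trace
    have hτ : ∀ p, τ p = ∑ s, if (a s, b s) = p then Z₁ s s else 0 := by
      intro p
      simp only [τ, Matrix.trace, Matrix.diag, hP, Matrix.mul_diagonal]
      refine Finset.sum_congr rfl fun s _ => ?_
      simp [hZdef, comp, Prod.ext_iff]
    have hτσ : ∀ p : ℤ × ℤ, τ (2 * p.2 - p.1, p.2) = τ p := by
      rintro ⟨i, j⟩
      rcases le_total j i with h | h
      · have := htr Z hZD hZP j (i - j).toNat
        rw [Int.toNat_of_nonneg (by omega)] at this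
        simp only [τ]
        rw [show 2 * j - i = j - (i - j) by ring, ← this, add_sub_cancel]
      · have := htr Z hZD hZP j (j - i).toNat
        rw [Int.toNat_of_nonneg (by omega)] at this
        simp only [τ]
        rw [show 2 * j - i = j + (j - i) by ring, this, sub_sub_cancel]
    let I : Finset (ℤ × ℤ) := Finset.univ.image fun s => (a s, b s)
    let F : Finset (ℤ × ℤ) := I ∪ I.image fun p => (2 * p.2 - p.1, p.2)
    have hF : ∀ p ∈ F, (2 * p.2 - p.1, p.2) ∈ F := by
      intro p hp
      rcases Finset.mem_union.1 hp with h | h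
      · exact Finset.mem_union_right _ (Finset.mem_image_of_mem _ h)
      · obtain ⟨q, hq, rfl⟩ := Finset.mem_image.1 h
        refine Finset.mem_union_left _ ?_
        simpa using hq
    have h1 : (Matrix.diagonal (fun s => ((a s - b s : ℤ) : ℚ)) * Z₁).trace =
        ∑ p ∈ F, ((p.1 - p.2 : ℤ) : ℚ) * τ p := by
      simp only [hτ, Finset.mul_sum, Matrix.trace, Matrix.diag, Matrix.diagonal_mul]
      rw [Finset.sum_comm]
      refine Finset.sum_congr rfl fun s _ => ?_
      rw [Finset.sum_eq_single (a s, b s)]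
      · simp
      · intro p _ hp
        rw [if_neg hp.symm, mul_zero]
      · intro h
        exact absurd (Finset.mem_union_left _ (Finset.mem_image_of_mem _ (Finset.mem_univ s))) h
    rw [h1]
    refine Finset.sum_involution (fun p _ => (2 * p.2 - p.1, p.2)) ?_ ?_ (fun p hp => hF p hp) ?_
    · intro p _
      rw [hτσ]
      push_cast
      ring
    · intro p _ hne heq
      have : p.1 = p.2 := by have := congrArg Prod.fst heq; simp only at this; omega
      exact hne (by simp [this])
    · intro p _
      ext <;> simp
  obtain ⟨E, hE⟩ := hmain
  refine ⟨comp 2 E, fun s t h => ?_, ?_⟩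
  · by_contra hc
    exact h (by simp only [comp, Matrix.of_apply]; rw [if_neg hc])
  · rw [hcompr, hcompl]
    ext s t
    have := congrFun (congrFun hE s) t
    simp only [comp, Matrix.sub_apply, Matrix.of_apply] at this ⊢
    split_ifs with h
    · exact this
    · have : s ≠ t := by rintro rfl; simp at h
      simp [this]

section Sl2

variable {M : Type*} [AddCommGroup M] [Module ℚ M] {E F H : Module.End ℚ M}

/-- The commutation relation of a raising operator with powers of a lowering operator on a
weight vector. -/
theorem raising_lowering_pow_apply (hEF : E * F - F * E = H) (hHF : H * F - F * H = (-2 : ℚ) • F)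
    {μ : ℚ} {v : M} (hv : H v = μ • v) (n : ℕ) :
    H ((F ^ n) v) = (μ - 2 * n) • (F ^ n) v ∧
      E ((F ^ (n + 1)) v) = (F ^ (n + 1)) (E v) + ((n + 1) * (μ - n)) • (F ^ n) v := by
  have hEF' : ∀ x, E (F x) = F (E x) + H x := fun x => by
    rw [← hEF]; simp
  have hHF' : ∀ x, H (F x) = F (H x) - (2 : ℚ) • F x := fun x => by
    have := LinearMap.congr_fun hHF x
    simp only [LinearMap.sub_apply, Module.End.mul_apply, LinearMap.smul_apply] at this
    rw [sub_eq_iff_eq_add.1 this]; module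
  induction n with
  | zero => simp [hv, hEF']
  | succ n ih =>
    have h1 : H ((F ^ (n + 1)) v) = (μ - 2 * (n + 1 : ℕ)) • (F ^ (n + 1)) v := by
      rw [pow_succ', Module.End.mul_apply, hHF', ih.1, map_smul]
      push_cast
      module
    refine ⟨h1, ?_⟩
    rw [pow_succ' F (n + 1), Module.End.mul_apply, Module.End.mul_apply, hEF', ih.2, h1, map_add,
      map_smul, ← Module.End.mul_apply F (F ^ n), ← pow_succ' F n]
    push_cast
    module

/-- On vectors of weight `m ≥ 0`, the `m`-th power of the lowering operator is injective. -/
theorem eq_zero_of_lowering_pow_apply_eq_zero (hEF : E * F - F * E = H)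
    (hHE : H * E - E * H = (2 : ℚ) • E) (hHF : H * F - F * H = (-2 : ℚ) • F)
    (q m : ℕ) {v : M} (hv : H v = (m : ℚ) • v) (hE : (E ^ q) v = 0) (hF : (F ^ m) v = 0) :
    v = 0 := by
  induction q generalizing m v with
  | zero => simpa using hE
  | succ q ih =>
    have hlow := fun n => (raising_lowering_pow_apply hEF hHF hv n).2
    have hEv : E v = 0 := by
      refine ih (m + 2) ?_ ?_ ?_
      · have := LinearMap.congr_fun hHE v
        simp only [LinearMap.sub_apply, Module.End.mul_apply, LinearMap.smul_apply, hv,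
          map_smul] at this
        rw [sub_eq_iff_eq_add.1 this]
        push_cast
        module
      · rw [← Module.End.mul_apply, ← pow_succ, hE]
      · have h1 := hlow (m + 1)
        have h2 : (F ^ (m + 1)) v = 0 := by rw [pow_succ', Module.End.mul_apply, hF, map_zero]
        have h3 : (F ^ (m + 1 + 1)) v = 0 := by rw [pow_succ', Module.End.mul_apply, h2, map_zero]
        rw [h2, h3, map_zero, smul_zero, add_zero] at h1
        exact h1.symm
    have hdown : ∀ k ≤ m, (F ^ (m - k)) v = 0 := by
      intro k
      induction k with
      | zero => intro _; simpa using hF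
      | succ k ihk =>
        intro hk
        have h1 := hlow (m - (k + 1))
        rw [show m - (k + 1) + 1 = m - k by omega, ihk (by omega), hEv, map_zero, map_zero,
          zero_add] at h1
        refine (smul_eq_zero.1 h1.symm).resolve_left (mul_ne_zero (by positivity) ?_)
        rw [Nat.cast_sub hk]
        push_cast
        ring_nf
        positivity
    simpa using hdown m le_rfl

/-- The hard Lefschetz property for graded representations of `sl₂`. -/
theorem lowering_pow_bijective [FiniteDimensional ℚ M] (hEF : E * F - F * E = H)
    (hHE : H * E - E * H = (2 : ℚ) • E) (hHF : H * F - F * H = (-2 : ℚ) • F)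
    (C : ℤ → Submodule ℚ M) (w : ℤ)
    (hE : ∀ n, ∀ x ∈ C n, E x ∈ C (n + 2)) (hF : ∀ n, ∀ x ∈ C n, F x ∈ C (n - 2))
    (hH : ∀ n, ∀ x ∈ C n, H x = ((n - w : ℤ) : ℚ) • x)
    (hC : ∃ K : ℤ, ∀ n, K ≤ |n| → C n = ⊥) (m : ℕ) :
    (∀ x ∈ C (w + m), (F ^ m) x = 0 → x = 0) ∧ C (w - m) ≤ (C (w + m)).map (F ^ m) := by
  have hEq : ∀ (q : ℕ) n, ∀ x ∈ C n, (E ^ q) x ∈ C (n + 2 * q) := by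
    intro q
    induction q with
    | zero => intro n x hx; simpa using hx
    | succ q ih =>
      intro n x hx
      rw [pow_succ', Module.End.mul_apply]
      convert hE _ _ (ih n x hx) using 2
      push_cast; ring
  have hFq : ∀ (q : ℕ) n, ∀ x ∈ C n, (F ^ q) x ∈ C (n - 2 * q) := by
    intro q
    induction q with
    | zero => intro n x hx; simpa using hx
    | succ q ih =>
      intro n x hx
      rw [pow_succ', Module.End.mul_apply]
      convert hF _ _ (ih n x hx) using 2
      push_cast; ring
  obtain ⟨K, hK⟩ := hC
  have hEnil : ∀ n, ∀ x ∈ C n, ∃ q : ℕ, (E ^ q) x = 0 := by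
    intro n x hx
    refine ⟨(|n| + |K|).toNat, ?_⟩
    have h1 := hEq (|n| + |K|).toNat n x hx
    rw [Int.toNat_of_nonneg (by positivity), hK] at h1
    · simpa using h1
    · have := le_abs_self K
      have := neg_abs_le n
      have := abs_nonneg n
      have := abs_nonneg K
      exact le_trans (by omega) (le_abs_self _)
  have hFnil : ∀ n, ∀ x ∈ C n, ∃ q : ℕ, (F ^ q) x = 0 := by
    intro n x hx
    refine ⟨(|n| + |K|).toNat, ?_⟩
    have h1 := hFq (|n| + |K|).toNat n x hx
    rw [Int.toNat_of_nonneg (by positivity), hK] at h1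
    · simpa using h1
    · have := le_abs_self K
      have := le_abs_self n
      have := abs_nonneg n
      have := abs_nonneg K
      exact le_trans (by omega) (neg_le_abs _)
  have hinjF : ∀ x ∈ C (w + m), (F ^ m) x = 0 → x = 0 := by
    intro x hx h0
    obtain ⟨q, hq⟩ := hEnil _ x hx
    refine eq_zero_of_lowering_pow_apply_eq_zero hEF hHE hHF q m ?_ hq h0
    rw [hH _ x hx]; congr 1; push_cast; ring
  have hinjE : ∀ x ∈ C (w - m), (E ^ m) x = 0 → x = 0 := by
    intro x hx h0
    obtain ⟨q, hq⟩ := hFnil _ x hx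
    refine eq_zero_of_lowering_pow_apply_eq_zero (E := F) (F := E) (H := -H) ?_ ?_ ?_ q m ?_ hq h0
    · rw [← hEF]; abel
    · rw [neg_mul, mul_neg, sub_neg_eq_add, neg_add_eq_sub, ← neg_sub, hHF]; module
    · rw [neg_mul, mul_neg, sub_neg_eq_add, neg_add_eq_sub, ← neg_sub, hHE]; module
    · rw [LinearMap.neg_apply, hH _ x hx, ← neg_smul]; congr 1; push_cast; ring
  refine ⟨hinjF, fun y hy => ?_⟩
  have hEm : ∀ x ∈ C (w - m), (E ^ m) x ∈ C (w + m) := fun x hx => by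
    convert hEq m _ x hx using 2; ring
  have hFm : ∀ x ∈ C (w + m), (F ^ m) x ∈ C (w - m) := fun x hx => by
    convert hFq m _ x hx using 2; ring
  let g : C (w - m) →ₗ[ℚ] C (w - m) :=
    (F ^ m * E ^ m).restrict fun x hx => hFm _ (hEm x hx)
  have hg : Function.Injective g := by
    rw [← LinearMap.ker_eq_bot, LinearMap.ker_eq_bot']
    intro x hx
    have := congrArg Subtype.val hx
    exact Subtype.ext (hinjE x x.2 (hinjF _ (hEm x x.2) this))
  obtain ⟨x, hx⟩ := LinearMap.injective_iff_surjective.1 hg ⟨y, hy⟩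
  exact ⟨(E ^ m) x, hEm x x.2, congrArg Subtype.val hx⟩

end Sl2

/-- If `N` agrees with a homogeneous operator `N₀` up to lower filtration, then the relative
monodromy condition for `N` on the graded quotients `G n / G (n - 1)` is equivalent to the hard
Lefschetz condition for `N₀` on complements `C n`. -/
theorem filtered_bijective_iff_graded {V : Type*} [AddCommGroup V] [Module ℚ V]
    {G C : ℤ → Submodule ℚ V} (hGC : ∀ n, G n = C n ⊔ G (n - 1))
    (hd : ∀ n, Disjoint (C n) (G (n - 1))) {N N₀ : Module.End ℚ V}
    (hN : ∀ n, ∀ x ∈ G n, N x ∈ G (n - 2)) (hN₀ : ∀ n, ∀ x ∈ C n, N₀ x ∈ C (n - 2))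
    (hN₀' : ∀ n, ∀ x ∈ G n, N₀ x ∈ G (n - 2))
    (hR : ∀ n, ∀ x ∈ G n, N x - N₀ x ∈ G (n - 3)) (w : ℤ) (m : ℕ) :
    ((∀ x ∈ G (w + m), (N ^ m) x ∈ G (w - m)) ∧
      (∀ x ∈ G (w + m - 1), (N ^ m) x ∈ G (w - m - 1)) ∧
      (∀ x ∈ G (w + m), (N ^ m) x ∈ G (w - m - 1) → x ∈ G (w + m - 1)) ∧
      G (w - m) ≤ (G (w + m)).map (N ^ m) ⊔ G (w - m - 1)) ↔
    ((∀ x ∈ C (w + m), (N₀ ^ m) x = 0 → x = 0) ∧ C (w - m) ≤ (C (w + m)).map (N₀ ^ m)) := by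
  have hCG : ∀ n, C n ≤ G n := fun n => (hGC n) ▸ le_sup_left
  have hGG : ∀ n, G (n - 1) ≤ G n := fun n => (hGC n) ▸ le_sup_right
  have hpow : ∀ (m : ℕ) n, ∀ x ∈ G n, (N ^ m) x ∈ G (n - 2 * m) ∧ (N₀ ^ m) x ∈ G (n - 2 * m) ∧
      (N ^ m) x - (N₀ ^ m) x ∈ G (n - 2 * m - 1) := by
    intro m
    induction m with
    | zero => intro n x hx; simpa using hx
    | succ m ih =>
      intro n x hx
      obtain ⟨h1, h2, h3⟩ := ih n x hx
      have e1 : n - 2 * ((m + 1 : ℕ) : ℤ) = n - 2 * m - 2 := by push_cast; ring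
      rw [pow_succ', pow_succ', Module.End.mul_apply, Module.End.mul_apply, e1]
      refine ⟨hN _ _ h1, hN₀' _ _ h2, ?_⟩
      have h4 : N ((N ^ m) x) - N₀ ((N₀ ^ m) x) =
          N ((N ^ m) x - (N₀ ^ m) x) + (N ((N₀ ^ m) x) - N₀ ((N₀ ^ m) x)) := by
        rw [map_sub]; abel
      rw [h4]
      refine add_mem ?_ ?_
      · convert hN _ _ h3 using 2; ring
      · convert hR _ _ h2 using 2; ring
  have hpowC : ∀ (m : ℕ) n, ∀ x ∈ C n, (N₀ ^ m) x ∈ C (n - 2 * m) := by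
    intro m
    induction m with
    | zero => intro n x hx; simpa using hx
    | succ m ih =>
      intro n x hx
      rw [pow_succ', Module.End.mul_apply]
      convert hN₀ _ _ (ih n x hx) using 2
      push_cast; ring
  have e1 : w + m - 2 * m = w - m := by ring
  have e2 : w + m - 1 - 2 * m = w - m - 1 := by ring
  have hNG : ∀ x ∈ G (w + m), (N ^ m) x ∈ G (w - m) := fun x hx => e1 ▸ (hpow m _ x hx).1
  have hNG' : ∀ x ∈ G (w + m - 1), (N ^ m) x ∈ G (w - m - 1) :=
    fun x hx => e2 ▸ (hpow m _ x hx).1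
  have hdiff : ∀ x ∈ G (w + m), (N ^ m) x - (N₀ ^ m) x ∈ G (w - m - 1) :=
    fun x hx => e1 ▸ (hpow m _ x hx).2.2
  have hNC : ∀ x ∈ C (w + m), (N₀ ^ m) x ∈ C (w - m) := fun x hx => e1 ▸ hpowC m _ x hx
  have hlead : ∀ c ∈ C (w + m), ∀ g ∈ G (w + m - 1),
      (N ^ m) (c + g) - (N₀ ^ m) c ∈ G (w - m - 1) := by
    intro c hc g hg
    rw [map_add, add_sub_right_comm]
    exact add_mem (hdiff c (hCG _ hc)) (hNG' g hg)
  constructor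
  · rintro ⟨-, -, hinj, hsurj⟩
    refine ⟨fun x hx h0 => ?_, fun y hy => ?_⟩
    · refine disjoint_def.1 (hd _) x hx (hinj x (hCG _ hx) ?_)
      simpa [h0] using hdiff x (hCG _ hx)
    · obtain ⟨_, ⟨x, hx, rfl⟩, r, hr, hxy⟩ := mem_sup.1 (hsurj (hCG _ hy))
      rw [SetLike.mem_coe, hGC] at hx
      obtain ⟨c, hc, g, hg, rfl⟩ := mem_sup.1 hx
      refine ⟨c, hc, (sub_eq_zero.1 (disjoint_def.1 (hd (w - m)) _ (sub_mem hy (hNC c hc)) ?_)).symm⟩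
      rw [← hxy, add_sub_right_comm]
      exact add_mem (hlead c hc g hg) hr
  · rintro ⟨hinj, hsurj⟩
    refine ⟨hNG, hNG', fun x hx hNx => ?_, fun y hy => ?_⟩
    · rw [hGC] at hx
      obtain ⟨c, hc, g, hg, rfl⟩ := mem_sup.1 hx
      have h1 : (N₀ ^ m) c ∈ G (w - m - 1) := by
        have := sub_mem hNx (hlead c hc g hg)
        rwa [sub_sub_cancel] at this
      rw [hinj c hc (disjoint_def.1 (hd _) _ (hNC c hc) h1), zero_add]
      exact hg
    · rw [hGC] at hy
      obtain ⟨d, hdC, g, hg, rfl⟩ := mem_sup.1 hy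
      obtain ⟨c, hc, rfl⟩ := hsurj hdC
      refine mem_sup.2 ⟨(N ^ m) c, ⟨c, hCG _ hc, rfl⟩, (N₀ ^ m) c - (N ^ m) c + g, ?_, by abel⟩
      refine add_mem ?_ hg
      rw [← neg_sub ((N ^ m) c)]
      exact neg_mem (hdiff c (hCG _ hc))

section Bigraded

variable {ι V : Type*} [AddCommGroup V] [Module ℚ V]

/-- The span of the basis vectors of bidegree `(n, w)`. -/
def gradedPiece (B : Module.Basis ι ℚ V) (a b : ι → ℤ) (n w : ℤ) : Submodule ℚ V :=
  span ℚ (B '' {s | a s = n ∧ b s = w})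

/-- The span of the basis vectors of bidegree `≤ (n, w)` or of second degree `< w`. -/
def filteredPiece (B : Module.Basis ι ℚ V) (a b : ι → ℤ) (n w : ℤ) : Submodule ℚ V :=
  span ℚ (B '' {s | a s ≤ n ∧ b s ≤ w ∨ b s ≤ w - 1})

variable (B : Module.Basis ι ℚ V) (a b : ι → ℤ)

theorem apply_mem_of_mem_span_image {V₂ : Type*} [AddCommGroup V₂] [Module ℚ V₂]
    {S : Set ι} {f : V →ₗ[ℚ] V₂} {T : Submodule ℚ V₂} (h : ∀ s ∈ S, f (B s) ∈ T) {x : V}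
    (hx : x ∈ span ℚ (B '' S)) : f x ∈ T := by
  have : span ℚ (B '' S) ≤ T.comap f := by
    rw [span_le]
    rintro _ ⟨s, hs, rfl⟩
    exact h s hs
  exact this hx

theorem span_image_inf_span_image (S T : Set ι) :
    span ℚ (B '' S) ⊓ span ℚ (B '' T) = span ℚ (B '' (S ∩ T)) := by
  ext x
  simp only [mem_inf, Module.Basis.mem_span_image, Set.subset_inter_iff]

theorem filteredPiece_eq_sup (n w : ℤ) :
    filteredPiece B a b n w = gradedPiece B a b n w ⊔ filteredPiece B a b (n - 1) w := by
  rw [filteredPiece, gradedPiece, filteredPiece, ← span_union, ← Set.image_union]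
  congr 2
  ext s
  simp only [Set.mem_ofPred_eq, Set.mem_union]
  omega

theorem disjoint_gradedPiece_filteredPiece (n w : ℤ) :
    Disjoint (gradedPiece B a b n w) (filteredPiece B a b (n - 1) w) := by
  refine B.linearIndependent.disjoint_span_image (Set.disjoint_left.2 fun s hs hs' => ?_)
  simp only [Set.mem_ofPred_eq] at hs hs'
  omega

theorem filteredPiece_mono {n n' w w' : ℤ} (hn : n ≤ n') (hw : w ≤ w') :
    filteredPiece B a b n w ≤ filteredPiece B a b n' w' := by
  refine span_mono (Set.image_mono fun s hs => ?_)
  simp only [Set.mem_ofPred_eq] at hs ⊢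
  omega

theorem filteredPiece_mono_of_lt {n n' w w' : ℤ} (hw : w < w') :
    filteredPiece B a b n w ≤ filteredPiece B a b n' w' := by
  refine span_mono (Set.image_mono fun s hs => ?_)
  simp only [Set.mem_ofPred_eq] at hs ⊢
  omega

theorem gradedPiece_le_filteredPiece (n w : ℤ) :
    gradedPiece B a b n w ≤ filteredPiece B a b n w :=
  filteredPiece_eq_sup B a b n w ▸ le_sup_left

theorem exists_gradedPiece_eq_bot [Fintype ι] :
    ∃ K : ℤ, ∀ n w : ℤ, K ≤ |n| → gradedPiece B a b n w = ⊥ := by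
  refine ⟨∑ s, |a s| + 1, fun n w hn => ?_⟩
  have : {s | a s = n ∧ b s = w} = ∅ := by
    refine Set.eq_empty_of_forall_notMem fun s hs => ?_
    have := Finset.single_le_sum (f := fun s => |a s|) (fun i _ => abs_nonneg _)
      (Finset.mem_univ s)
    simp only [hs.1] at this
    omega
  rw [gradedPiece, this]
  simp

theorem grSub_eq_filteredPiece {W W' : ℤ → Submodule ℚ V}
    (hW : ∀ w, W w = span ℚ (B '' {s | b s ≤ w})) (hW' : ∀ w, W' w = span ℚ (B '' {s | a s ≤ w}))
    (w n : ℤ) : grSub W W' w n = filteredPiece B a b n w := by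
  rw [grSub, hW, hW', hW, span_image_inf_span_image, ← span_union, ← Set.image_union]
  rfl

variable [Fintype ι] [DecidableEq ι]

/-- Membership in a span of elementary endomorphisms can be checked column by column. -/
theorem mem_span_end_image_iff {S : Set (ι × ι)} {f : Module.End ℚ V} :
    f ∈ span ℚ (B.end '' S) ↔ ∀ t, f (B t) ∈ span ℚ (B '' {s | (s, t) ∈ S}) := by
  have hrepr : ∀ s t, B.end.repr f (s, t) = B.repr (f (B t)) s := fun s t => by
    have h : B.end.coord (s, t) = B.coord s ∘ₗ LinearMap.applyₗ (B t) := by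
      refine B.end.ext fun p => ?_
      rw [Module.Basis.coord_apply, Module.Basis.repr_self, LinearMap.comp_apply,
        LinearMap.applyₗ_apply_apply, Module.Basis.end_apply_apply, Finsupp.single_apply]
      by_cases h1 : p.1 = s <;> by_cases h2 : p.2 = t <;> simp [h1, h2, Prod.ext_iff]
    exact LinearMap.congr_fun h f
  simp only [Module.Basis.mem_span_image, Set.subset_def, Finset.mem_coe, Finsupp.mem_support_iff,
    Prod.forall, hrepr, Set.mem_ofPred_eq]
  exact forall_comm

/-- The degree function induced on elementary endomorphisms. -/
def endDeg (a : ι → ℤ) (p : ι × ι) : ℤ := a p.1 - a p.2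

theorem endFilt_eq_span {W : ℤ → Submodule ℚ V} (hW : ∀ w, W w = span ℚ (B '' {s | b s ≤ w}))
    (k : ℤ) : endFilt W k = span ℚ (B.end '' {p | endDeg b p ≤ k}) := by
  have hset : ∀ t, {s | (s, t) ∈ {p : ι × ι | endDeg b p ≤ k}} = {s | b s ≤ b t + k} := fun t => by
    ext s; simp only [endDeg, Set.mem_ofPred_eq]; omega
  ext f
  rw [mem_span_end_image_iff]
  simp only [hset, ← hW]
  refine ⟨fun hf t => hf _ _ ?_, fun hf w x hx => ?_⟩
  · rw [hW]
    exact subset_span ⟨t, le_refl (b t), rfl⟩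
  · rw [hW] at hx
    refine apply_mem_of_mem_span_image B (fun s hs => ?_) hx
    have := hf s
    rw [hW] at this ⊢
    refine span_mono (Set.image_mono fun u hu => ?_) this
    simp only [Set.mem_ofPred_eq] at hs hu ⊢
    omega

theorem mem_gradedPiece_end_iff {n w : ℤ} {f : Module.End ℚ V} :
    f ∈ gradedPiece B.end (endDeg a) (endDeg b) n w ↔
      ∀ t, f (B t) ∈ gradedPiece B a b (a t + n) (b t + w) := by
  rw [gradedPiece, mem_span_end_image_iff]
  refine forall_congr' fun t => ?_
  rw [gradedPiece]
  convert Iff.rfl using 5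
  ext s
  simp only [endDeg, Set.mem_ofPred_eq]
  omega

theorem mem_filteredPiece_end_iff {n w : ℤ} {f : Module.End ℚ V} :
    f ∈ filteredPiece B.end (endDeg a) (endDeg b) n w ↔
      ∀ t, f (B t) ∈ filteredPiece B a b (a t + n) (b t + w) := by
  rw [filteredPiece, mem_span_end_image_iff]
  refine forall_congr' fun t => ?_
  rw [filteredPiece]
  convert Iff.rfl using 5
  ext s
  simp only [endDeg, Set.mem_ofPred_eq]
  omega

variable {B a b} {n w n' w' : ℤ} {f g : Module.End ℚ V} {x : V}

theorem apply_mem_gradedPiece (hf : f ∈ gradedPiece B.end (endDeg a) (endDeg b) n w)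
    (hx : x ∈ gradedPiece B a b n' w') : f x ∈ gradedPiece B a b (n' + n) (w' + w) := by
  refine apply_mem_of_mem_span_image B (fun s hs => ?_) hx
  have := (mem_gradedPiece_end_iff B a b).1 hf s
  rwa [hs.1, hs.2] at this

theorem apply_mem_filteredPiece (hf : f ∈ filteredPiece B.end (endDeg a) (endDeg b) n w)
    (hx : x ∈ filteredPiece B a b n' w') : f x ∈ filteredPiece B a b (n' + n) (w' + w) := by
  refine apply_mem_of_mem_span_image B (fun s hs => ?_) hx
  have := (mem_filteredPiece_end_iff B a b).1 hf s
  rcases hs with ⟨h1, h2⟩ | h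
  · exact filteredPiece_mono B a b (by omega) (by omega) this
  · exact filteredPiece_mono_of_lt B a b (by omega) this

theorem mul_mem_gradedPiece_end (hf : f ∈ gradedPiece B.end (endDeg a) (endDeg b) n w)
    (hg : g ∈ gradedPiece B.end (endDeg a) (endDeg b) n' w') :
    f * g ∈ gradedPiece B.end (endDeg a) (endDeg b) (n + n') (w + w') := by
  rw [mem_gradedPiece_end_iff] at hg ⊢
  intro t
  rw [Module.End.mul_apply]
  convert apply_mem_gradedPiece hf (hg t) using 2 <;> ring

theorem mul_mem_filteredPiece_end (hf : f ∈ filteredPiece B.end (endDeg a) (endDeg b) n w)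
    (hg : g ∈ filteredPiece B.end (endDeg a) (endDeg b) n' w') :
    f * g ∈ filteredPiece B.end (endDeg a) (endDeg b) (n + n') (w + w') := by
  rw [mem_filteredPiece_end_iff] at hg ⊢
  intro t
  rw [Module.End.mul_apply]
  convert apply_mem_filteredPiece hf (hg t) using 2 <;> ring

theorem adE_apply_mem_gradedPiece (hf : f ∈ gradedPiece B.end (endDeg a) (endDeg b) n w)
    (hg : g ∈ gradedPiece B.end (endDeg a) (endDeg b) n' w') :
    adE f g ∈ gradedPiece B.end (endDeg a) (endDeg b) (n' + n) (w' + w) := by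
  simp only [adE, LinearMap.sub_apply, LinearMap.mulLeft_apply, LinearMap.mulRight_apply]
  refine sub_mem ?_ (mul_mem_gradedPiece_end hg hf)
  convert mul_mem_gradedPiece_end hf hg using 1
  rw [add_comm n, add_comm w]

theorem adE_apply_mem_filteredPiece (hf : f ∈ filteredPiece B.end (endDeg a) (endDeg b) n w)
    (hg : g ∈ filteredPiece B.end (endDeg a) (endDeg b) n' w') :
    adE f g ∈ filteredPiece B.end (endDeg a) (endDeg b) (n' + n) (w' + w) := by
  simp only [adE, LinearMap.sub_apply, LinearMap.mulLeft_apply, LinearMap.mulRight_apply]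
  refine sub_mem ?_ (mul_mem_filteredPiece_end hg hf)
  convert mul_mem_filteredPiece_end hf hg using 1
  rw [add_comm n, add_comm w]

/-- The operator acting on the basis vector of bidegree `(i, j)` by `i - j`. -/
noncomputable def relWeight (B : Module.Basis ι ℚ V) (a b : ι → ℤ) : Module.End ℚ V :=
  Matrix.toLinAlgEquiv B (Matrix.diagonal fun s => ((a s - b s : ℤ) : ℚ))

theorem relWeight_apply_basis (s : ι) :
    relWeight B a b (B s) = ((a s - b s : ℤ) : ℚ) • B s := by
  rw [relWeight, Matrix.toLinAlgEquiv_self, Finset.sum_eq_single s]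
  · rw [Matrix.diagonal_apply_eq]
  · intro t _ ht
    rw [Matrix.diagonal_apply_ne _ ht, zero_smul]
  · simp

theorem relWeight_apply (hx : x ∈ gradedPiece B a b n w) :
    relWeight B a b x = ((n - w : ℤ) : ℚ) • x := by
  have : (relWeight B a b - ((n - w : ℤ) : ℚ) • 1) x ∈ (⊥ : Submodule ℚ V) := by
    refine apply_mem_of_mem_span_image B (fun s hs => ?_) hx
    rw [mem_bot, LinearMap.sub_apply, relWeight_apply_basis, hs.1, hs.2]
    simp
  simpa [sub_eq_zero] using this

theorem adE_relWeight_apply (hf : f ∈ gradedPiece B.end (endDeg a) (endDeg b) n w) :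
    adE (relWeight B a b) f = ((n - w : ℤ) : ℚ) • f := by
  refine B.ext fun t => ?_
  have h1 := relWeight_apply ((mem_gradedPiece_end_iff B a b).1 hf t)
  simp only [adE, LinearMap.sub_apply, LinearMap.mulLeft_apply, LinearMap.mulRight_apply,
    Module.End.mul_apply, LinearMap.smul_apply, h1, relWeight_apply_basis, map_smul]
  rw [← sub_smul]
  congr 1
  push_cast
  ring

theorem mem_gradedPiece_end_of_toMatrix (h : ∀ s t, LinearMap.toMatrixAlgEquiv B f s t ≠ 0 →
    a s = a t + n ∧ b s = b t + w) : f ∈ gradedPiece B.end (endDeg a) (endDeg b) n w := by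
  rw [mem_gradedPiece_end_iff]
  intro t
  rw [gradedPiece, Module.Basis.mem_span_image]
  intro s hs
  exact h s t (by simpa [LinearMap.toMatrixAlgEquiv_apply] using hs)

theorem toMatrix_ne_zero_of_mem_gradedPiece_end
    (hf : f ∈ gradedPiece B.end (endDeg a) (endDeg b) n w) (s t : ι)
    (h : LinearMap.toMatrixAlgEquiv B f s t ≠ 0) : a s = a t + n ∧ b s = b t + w := by
  have := (mem_gradedPiece_end_iff B a b).1 hf t
  rw [gradedPiece, Module.Basis.mem_span_image] at this
  exact this (by simpa [LinearMap.toMatrixAlgEquiv_apply] using h)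

/-- The existence of a raising operator for a homogeneous operator with the hard Lefschetz
property. -/
theorem exists_raising {N₀ : Module.End ℚ V}
    (hN₀ : N₀ ∈ gradedPiece B.end (endDeg a) (endDeg b) (-2) 0)
    (hL : ∀ (w : ℤ) (m : ℕ), (∀ x ∈ gradedPiece B a b (w + m) w, (N₀ ^ m) x = 0 → x = 0) ∧
      gradedPiece B a b (w - m) w ≤ (gradedPiece B a b (w + m) w).map (N₀ ^ m)) :
    ∃ e ∈ gradedPiece B.end (endDeg a) (endDeg b) 2 0, e * N₀ - N₀ * e = relWeight B a b := by
  let P : ℤ → ℤ → Matrix ι ι ℚ := fun i j =>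
    Matrix.diagonal fun s => if a s = i ∧ b s = j then 1 else 0
  let p : ℤ → ℤ → Module.End ℚ V := fun i j => Matrix.toLinAlgEquiv B (P i j)
  have hpB : ∀ i j s, p i j (B s) = if a s = i ∧ b s = j then B s else 0 := by
    intro i j s
    simp only [p, P]
    rw [Matrix.toLinAlgEquiv_self, Finset.sum_eq_single s]
    · rw [Matrix.diagonal_apply_eq]; split_ifs <;> simp
    · intro t _ ht
      rw [Matrix.diagonal_apply_ne _ ht, zero_smul]
    · simp
  have hpmem : ∀ i j x, p i j x ∈ gradedPiece B a b i j := by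
    intro i j x
    refine apply_mem_of_mem_span_image (S := Set.univ) B (fun s _ => ?_) (by simp [B.span_eq])
    rw [hpB]
    split_ifs with h
    · exact subset_span ⟨s, h, rfl⟩
    · exact zero_mem _
  have hpid : ∀ i j, ∀ x ∈ gradedPiece B a b i j, p i j x = x := by
    intro i j x hx
    have : (p i j - 1) x ∈ (⊥ : Submodule ℚ V) := by
      refine apply_mem_of_mem_span_image B (fun s hs => ?_) hx
      rw [LinearMap.sub_apply, hpB, if_pos (show a s = i ∧ b s = j from hs)]
      simp
    simpa [sub_eq_zero] using this
  obtain ⟨E, hE, hED⟩ := exists_raising_matrix a b P (fun _ _ => rfl)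
    (LinearMap.toMatrixAlgEquiv B N₀)
    (fun s t h => by
      have := toMatrix_ne_zero_of_mem_gradedPiece_end hN₀ s t h
      omega)
    (fun w m => by
      obtain ⟨hinj, hsurj⟩ := hL w m
      have hker : LinearMap.ker ((N₀ ^ m).domRestrict (gradedPiece B a b (w + m) w)) = ⊥ := by
        rw [LinearMap.ker_eq_bot']
        intro x hx
        exact Subtype.ext (hinj x x.2 hx)
      obtain ⟨g, hg⟩ := LinearMap.exists_leftInverse_of_injective _ hker
      have hg' : ∀ x ∈ gradedPiece B a b (w + m) w, (g ((N₀ ^ m) x) : V) = x := fun x hx =>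
        congrArg Subtype.val (LinearMap.congr_fun hg ⟨x, hx⟩)
      let S : Module.End ℚ V := (gradedPiece B a b (w + m) w).subtype ∘ₗ g
      have hPp : ∀ i j, P i j = LinearMap.toMatrixAlgEquiv B (p i j) := fun i j =>
        (LinearMap.toMatrixAlgEquiv_toLinAlgEquiv B _).symm
      refine ⟨LinearMap.toMatrixAlgEquiv B S, ?_, ?_, ?_⟩
      · have hST : S * N₀ ^ m * p (w + m) w = p (w + m) w :=
          LinearMap.ext fun x => hg' _ (hpmem (w + m) w x)
        rw [hPp, ← map_pow, ← map_mul, ← map_mul, hST]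
      · have hTS : N₀ ^ m * S * p (w - m) w = p (w - m) w := by
          refine LinearMap.ext fun x => ?_
          obtain ⟨y, hy, hyx⟩ := hsurj (hpmem (w - m) w x)
          rw [Module.End.mul_apply, Module.End.mul_apply, ← hyx]
          exact congrArg _ (hg' y hy)
        rw [hPp, ← map_pow, ← map_mul, ← map_mul, hTS]
      · have hpS : p (w + m) w * S = S := LinearMap.ext fun x => hpid (w + m) w (g x) (g x).2
        rw [hPp, ← map_mul, hpS])
  refine ⟨Matrix.toLinAlgEquiv B E, mem_gradedPiece_end_of_toMatrix fun s t h => ?_, ?_⟩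
  · rw [LinearMap.toMatrixAlgEquiv_toLinAlgEquiv] at h
    have := hE s t h
    omega
  · rw [relWeight, ← hED, map_sub, map_mul, map_mul, Matrix.toLinAlgEquiv_toMatrixAlgEquiv]

end Bigraded

section Main

variable {V : Type*} [AddCommGroup V] [Module ℚ V]

theorem adE_sub (f g : Module.End ℚ V) : adE (f - g) = adE f - adE g := by
  refine LinearMap.ext fun x => ?_
  simp only [adE, LinearMap.sub_apply, LinearMap.mulLeft_apply, LinearMap.mulRight_apply]
  noncomm_ring

theorem adE_mul_sub_mul (f g : Module.End ℚ V) :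
    adE f * adE g - adE g * adE f = adE (f * g - g * f) := by
  refine LinearMap.ext fun x => ?_
  simp only [adE, LinearMap.sub_apply, LinearMap.mulLeft_apply, LinearMap.mulRight_apply,
    Module.End.mul_apply]
  noncomm_ring

theorem adE_smul (c : ℚ) (f : Module.End ℚ V) : adE (c • f) = c • adE f := by
  refine LinearMap.ext fun x => ?_
  simp [adE, smul_sub]

theorem endFilt_isFiniteFiltration {W : ℤ → Submodule ℚ V} (hW : IsFiniteFiltration W) :
    IsFiniteFiltration (endFilt W) := by
  obtain ⟨hm, ⟨a, ha⟩, b, hb⟩ := hW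
  refine ⟨fun k l hkl f hf w x hx => hm (by omega) (hf w x hx), ⟨a - b, fun k hk => ?_⟩,
    b - a, fun k hk => ?_⟩
  · rw [eq_bot_iff]
    intro f hf
    rw [mem_bot]
    refine LinearMap.ext fun x => ?_
    have := hf b x (by rw [hb _ le_rfl]; trivial)
    rw [ha _ (by omega)] at this
    simpa using this
  · rw [eq_top_iff]
    intro f _ w x hx
    rcases le_or_gt w a with h | h
    · rw [ha _ h, mem_bot] at hx
      rw [hx, map_zero]
      exact zero_mem _
    · rw [hb _ (by omega)]
      trivial

/-- The relative monodromy isomorphisms in terms of a homogeneous leading part of `N` with respect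
to an adapted basis. -/
theorem grSub_bijective_iff {ι : Type*} [Fintype ι] [DecidableEq ι] {B : Module.Basis ι ℚ V}
    {a b : ι → ℤ} {W W' : ℤ → Submodule ℚ V}
    (hW : ∀ w, W w = span ℚ (B '' {s | b s ≤ w})) (hW' : ∀ w, W' w = span ℚ (B '' {s | a s ≤ w}))
    {N N₀ : Module.End ℚ V}
    (hN : ∀ w n, ∀ x ∈ filteredPiece B a b n w, N x ∈ filteredPiece B a b (n - 2) w)
    (hN₀ : ∀ w n, ∀ x ∈ gradedPiece B a b n w, N₀ x ∈ gradedPiece B a b (n - 2) w)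
    (hN₀' : ∀ w n, ∀ x ∈ filteredPiece B a b n w, N₀ x ∈ filteredPiece B a b (n - 2) w)
    (hR : ∀ w n, ∀ x ∈ filteredPiece B a b n w, N x - N₀ x ∈ filteredPiece B a b (n - 3) w)
    (w : ℤ) (m : ℕ) :
    ((∀ x ∈ grSub W W' w (w + m), (N ^ m) x ∈ grSub W W' w (w - m)) ∧
      (∀ x ∈ grSub W W' w (w + m - 1), (N ^ m) x ∈ grSub W W' w (w - m - 1)) ∧
      (∀ x ∈ grSub W W' w (w + m), (N ^ m) x ∈ grSub W W' w (w - m - 1) →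
        x ∈ grSub W W' w (w + m - 1)) ∧
      grSub W W' w (w - m) ≤
        (grSub W W' w (w + m)).map (N ^ m) ⊔ grSub W W' w (w - m - 1)) ↔
    ((∀ x ∈ gradedPiece B a b (w + m) w, (N₀ ^ m) x = 0 → x = 0) ∧
      gradedPiece B a b (w - m) w ≤ (gradedPiece B a b (w + m) w).map (N₀ ^ m)) := by
  simp only [grSub_eq_filteredPiece B a b hW hW']
  exact filtered_bijective_iff_graded (G := fun n => filteredPiece B a b n w)
    (C := fun n => gradedPiece B a b n w) (fun n => filteredPiece_eq_sup B a b n w)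
    (fun n => disjoint_gradedPiece_filteredPiece B a b n w) (hN w) (hN₀ w) (hN₀' w) (hR w) w m

end Main

/-- if `W'` is the relative monodromy filtration of `N` with respect to `W`,
then the induced filtration `W'_• End(V)` is the relative monodromy filtration of
`Ad(N) : f ↦ N∘f - f∘N` with respect to the induced filtration `W_• End(V)`. -/
theorem endomorphism_relative_monodromy
    {V : Type*} [AddCommGroup V] [Module ℚ V] [FiniteDimensional ℚ V]
    (W W' : ℤ → Submodule ℚ V) (hW : IsFiniteFiltration W)
    (N : Module.End ℚ V) (hNnil : IsNilpotent N)
    (hNW : ∀ w : ℤ, ∀ x ∈ W w, N x ∈ W w)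
    (h : IsRelMonFil N W W') :
    IsRelMonFil (adE N) (endFilt W) (endFilt W') := by
  classical
  obtain ⟨hW'fin, hNW', hiso⟩ := h
  obtain ⟨ι, _, B, a, b, hWB, hWB'⟩ := exists_adapted_basis hW hW'fin
  have hEW := endFilt_eq_span B b hWB
  have hEW' := endFilt_eq_span B a hWB'
  have hNmem : N ∈ filteredPiece B.end (endDeg a) (endDeg b) (-2) 0 := by
    rw [← grSub_eq_filteredPiece B.end (endDeg a) (endDeg b) hEW hEW']
    refine mem_sup_left ⟨fun w x hx => hNW' w x hx, fun w x hx => ?_⟩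
    rw [add_zero]
    exact hNW w x hx
  obtain ⟨N₀, hN₀, R, hR, hNR⟩ := mem_sup.1 (filteredPiece_eq_sup B.end _ _ _ _ ▸ hNmem)
  have hN₀' := gradedPiece_le_filteredPiece _ _ _ _ _ hN₀
  have hRN : R = N - N₀ := by rw [← hNR]; abel
  have hL := fun w m => (grSub_bijective_iff hWB hWB' (N := N) (N₀ := N₀)
    (fun w n x hx => by simpa [← sub_eq_add_neg] using apply_mem_filteredPiece hNmem hx)
    (fun w n x hx => by simpa [← sub_eq_add_neg] using apply_mem_gradedPiece hN₀ hx)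
    (fun w n x hx => by simpa [← sub_eq_add_neg] using apply_mem_filteredPiece hN₀' hx)
    (fun w n x hx => by
      have := apply_mem_filteredPiece hR hx
      rw [hRN] at this
      simpa [← sub_eq_add_neg] using this) w m).1 (hiso w m)
  obtain ⟨e, he, heN⟩ := exists_raising hN₀ hL
  refine ⟨endFilt_isFiniteFiltration hW'fin, fun k f hf w x hx => ?_, fun w m => ?_⟩
  · simp only [adE, LinearMap.sub_apply, LinearMap.mulLeft_apply, LinearMap.mulRight_apply,
      Module.End.mul_apply]
    refine sub_mem ?_ ?_
    · convert hNW' _ _ (hf w x hx) using 2; ring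
    · convert hf _ _ (hNW' w x hx) using 2; ring
  · refine (grSub_bijective_iff hEW hEW' (N := adE N) (N₀ := adE N₀)
      (fun w n x hx => by simpa [← sub_eq_add_neg] using adE_apply_mem_filteredPiece hNmem hx)
      (fun w n x hx => by simpa [← sub_eq_add_neg] using adE_apply_mem_gradedPiece hN₀ hx)
      (fun w n x hx => by simpa [← sub_eq_add_neg] using adE_apply_mem_filteredPiece hN₀' hx)
      (fun w n x hx => by
        have := adE_apply_mem_filteredPiece hR hx
        rw [hRN, adE_sub] at this
        simpa [← sub_eq_add_neg] using this) w m).2 ?_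
    obtain ⟨K, hK⟩ := exists_gradedPiece_eq_bot B.end (endDeg a) (endDeg b)
    refine lowering_pow_bijective (E := adE e) (H := adE (relWeight B a b)) ?_ ?_ ?_
      (fun n => gradedPiece B.end (endDeg a) (endDeg b) n w) w
      (fun n x hx => by simpa using adE_apply_mem_gradedPiece he hx)
      (fun n x hx => by simpa [← sub_eq_add_neg] using adE_apply_mem_gradedPiece hN₀ hx)
      (fun n x hx => adE_relWeight_apply hx) ⟨K, fun n hn => hK n w hn⟩ m
    · rw [adE_mul_sub_mul, heN]
    · rw [adE_mul_sub_mul, ← adE_smul]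
      congr 1
      simpa [adE] using adE_relWeight_apply he
    · rw [adE_mul_sub_mul, ← adE_smul]
      congr 1
      simpa [adE] using adE_relWeight_apply hN₀
end
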